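/- Let μ be a Borel probability measure on ℝ^N with finite second moment whose support has at least k points, suppose μ_m → μ in the 2-Wasserstein distance, and let z_m be a minimizer of F_{μ_m,k} for each m. Then the sequence (z_m) is precompact in (ℝ^N)^k and every accumulation point is a minimizer of F_{μ,k}. -/

import Mathlib

open MeasureTheory Filter

/-- The 2-Wasserstein distance between two Borel probability measures on `ℝ^N`. -/
noncomputable def wasserstein2 {N : ℕ} (μ ν : Measure (EuclideanSpace ℝ (Fin N))) : ℝ :=
  sInf { r : ℝ | ∃ π : Measure (EuclideanSpace ℝ (Fin N) × EuclideanSpace ℝ (Fin N)),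
      π.fst = μ ∧ π.snd = ν ∧ r = Real.sqrt (∫ p, dist p.1 p.2 ^ 2 ∂π) }

/-- The k-means functional `F_{μ,k}(z) = ∫ min_i |x - z_i|² dμ(x)`. -/
noncomputable def kmeansF {N k : ℕ} (μ : Measure (EuclideanSpace ℝ (Fin N)))
    (z : Fin k → EuclideanSpace ℝ (Fin N)) : ℝ :=
  ∫ x, (⨅ i, dist x (z i)) ^ 2 ∂μ

/-- The support of a Borel measure. -/
def measSupport {N : ℕ} (μ : Measure (EuclideanSpace ℝ (Fin N))) :
    Set (EuclideanSpace ℝ (Fin N)) :=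
  {x | ∀ ε > 0, 0 < μ (Metric.ball x ε)}

open scoped Topology

section MinDist

variable {X : Type*} [PseudoMetricSpace X] {ι : Type*}

lemma ciInf_dist_nonneg (z : ι → X) (x : X) : 0 ≤ ⨅ j, dist x (z j) :=
  Real.iInf_nonneg fun _ => dist_nonneg

variable [Finite ι]

lemma ciInf_dist_le (z : ι → X) (x : X) (i : ι) : ⨅ j, dist x (z j) ≤ dist x (z i) :=
  ciInf_le (Set.finite_range _).bddBelow i

lemma ciInf_dist_le_add [Nonempty ι] (z w : ι → X) (x y : X) (c : ℝ)
    (h : ∀ i, dist x (z i) ≤ dist y (w i) + c) :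
    ⨅ i, dist x (z i) ≤ (⨅ i, dist y (w i)) + c := by
  rw [← sub_le_iff_le_add]
  exact le_ciInf fun i => by linarith [ciInf_dist_le z x i, h i]

lemma continuous_ciInf_dist [Nonempty ι] (z : ι → X) :
    Continuous fun x => ⨅ i, dist x (z i) := by
  refine (LipschitzWith.of_le_add (f := fun x => ⨅ i, dist x (z i)) fun x y => ?_).continuous
  exact ciInf_dist_le_add z z x y _ fun i => by linarith [dist_triangle x y (z i)]

end MinDist

/-- Minkowski's inequality in `L²` for real functions, together with monotonicity. -/
lemma sqrt_integral_sq_le_add {α : Type*} [MeasurableSpace α] {μ : Measure α} {f g h : α → ℝ}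
    (hf : MemLp f 2 μ) (hg : MemLp g 2 μ) (hh : AEStronglyMeasurable h μ)
    (h0 : ∀ x, 0 ≤ h x) (hle : ∀ x, h x ≤ f x + g x) :
    √(∫ x, h x ^ 2 ∂μ) ≤ √(∫ x, f x ^ 2 ∂μ) + √(∫ x, g x ^ 2 ∂μ) := by
  have key : ∀ u : α → ℝ, AEStronglyMeasurable u μ → √(∫ x, u x ^ 2 ∂μ) = lpNorm u 2 μ := by
    intro u hu
    rw [lpNorm_eq_integral_norm_rpow_toReal (by simp) (by simp) hu, Real.sqrt_eq_rpow]
    simp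
  rw [key f hf.1, key g hg.1, key h hh]
  refine (lpNorm_mono_real (hf.add hg) fun x => ?_).trans (lpNorm_add_le hf (by norm_num))
  rw [Real.norm_of_nonneg (h0 x)]
  exact hle x

lemma memLp_two_norm_of_integrable_sq {E : Type*} [NormedAddCommGroup E] [MeasurableSpace E]
    [OpensMeasurableSpace E] [SecondCountableTopology E] {μ : Measure E}
    (h : Integrable (fun x => ‖x‖ ^ 2) μ) : MemLp (fun x : E => x) 2 μ :=
  (memLp_two_iff_integrable_sq_norm continuous_id.aestronglyMeasurable).2 h

/-- Each coordinate of a sequence of tuples can be assumed, up to extraction, to converge or to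
escape to infinity. -/
lemma exists_subseq_tendsto_or_norm_atTop {E ι : Type*} [NormedAddCommGroup E] [ProperSpace E]
    (s : Finset ι) (u : ℕ → ι → E) :
    ∃ φ : ℕ → ℕ, StrictMono φ ∧ ∀ i ∈ s,
      (∃ a, Tendsto (fun m => u (φ m) i) atTop (𝓝 a)) ∨
        Tendsto (fun m => ‖u (φ m) i‖) atTop atTop := by
  classical
  induction s using Finset.induction_on with
  | empty => exact ⟨id, strictMono_id, by simp⟩
  | insert j s _ ih =>
    obtain ⟨φ, hφ, hs⟩ := ih
    by_cases hj : Tendsto (fun m => ‖u (φ m) j‖) atTop atTop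
    · exact ⟨φ, hφ, (Finset.forall_mem_insert ..).2 ⟨Or.inr hj, hs⟩⟩
    · rw [tendsto_atTop] at hj
      push Not at hj
      obtain ⟨C, hC⟩ := hj
      have hfr : ∃ᶠ m in atTop, u (φ m) j ∈ Metric.closedBall (0 : E) C :=
        hC.mono fun m hm => by simpa using hm.le
      obtain ⟨a, -, ψ, hψ, ha⟩ :=
        tendsto_subseq_of_frequently_bounded Metric.isBounded_closedBall hfr
      refine ⟨φ ∘ ψ, hφ.comp hψ, ?_⟩
      simp only [Finset.mem_insert, forall_eq_or_imp]
      refine ⟨Or.inl ⟨a, ha⟩, fun i hi => (hs i hi).imp ?_ ?_⟩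
      · rintro ⟨b, hb⟩
        exact ⟨b, hb.comp hψ.tendsto_atTop⟩
      · exact fun h => h.comp hψ.tendsto_atTop

section KMeans

variable {N k : ℕ}

lemma memLp_ciInf_dist [NeZero k] {μ : Measure (EuclideanSpace ℝ (Fin N))}
    [IsFiniteMeasure μ] (h2 : Integrable (fun x => ‖x‖ ^ 2) μ)
    (z : Fin k → EuclideanSpace ℝ (Fin N)) :
    MemLp (fun x => ⨅ i, dist x (z i)) 2 μ := by
  refine ((memLp_two_norm_of_integrable_sq h2).norm.add (memLp_const ‖z 0‖)).mono
    (continuous_ciInf_dist z).aestronglyMeasurable (.of_forall fun x => ?_)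
  rw [Real.norm_of_nonneg (ciInf_dist_nonneg z x)]
  refine (ciInf_dist_le z x 0).trans ((dist_le_norm_add_norm _ _).trans ?_)
  exact le_abs_self _

lemma sqrt_kmeansF_le_add_dist [NeZero k] {μ : Measure (EuclideanSpace ℝ (Fin N))}
    [IsProbabilityMeasure μ] (h2 : Integrable (fun x => ‖x‖ ^ 2) μ)
    (z w : Fin k → EuclideanSpace ℝ (Fin N)) :
    √(kmeansF μ z) ≤ √(kmeansF μ w) + dist z w := by
  have := sqrt_integral_sq_le_add (memLp_ciInf_dist h2 w) (memLp_const (μ := μ) (dist z w))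
    (continuous_ciInf_dist z).aestronglyMeasurable (ciInf_dist_nonneg z)
    (fun x => ciInf_dist_le_add z w x x _ fun i => by
      linarith [dist_triangle x (w i) (z i), dist_le_pi_dist z w i, dist_comm (z i) (w i)])
  simpa [kmeansF, Real.sqrt_sq dist_nonneg] using this

/-- For a fixed tuple, `√F` is `1`-Lipschitz with respect to the Wasserstein distance. -/
lemma abs_sqrt_kmeansF_sub_le_wasserstein2 [NeZero k]
    {μ ν : Measure (EuclideanSpace ℝ (Fin N))}
    [IsProbabilityMeasure μ] [IsProbabilityMeasure ν]
    (h2μ : Integrable (fun x => ‖x‖ ^ 2) μ) (h2ν : Integrable (fun x => ‖x‖ ^ 2) ν)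
    (z : Fin k → EuclideanSpace ℝ (Fin N)) :
    |√(kmeansF μ z) - √(kmeansF ν z)| ≤ wasserstein2 μ ν := by
  refine le_csInf ⟨_, μ.prod ν, by simp, by simp, rfl⟩ ?_
  rintro r ⟨π, rfl, rfl, rfl⟩
  have mp1 : MeasurePreserving Prod.fst π π.fst := ⟨measurable_fst, rfl⟩
  have mp2 : MeasurePreserving Prod.snd π π.snd := ⟨measurable_snd, rfl⟩
  have hc := continuous_ciInf_dist z
  have l1 := (memLp_ciInf_dist h2μ z).comp_measurePreserving mp1
  have l2 := (memLp_ciInf_dist h2ν z).comp_measurePreserving mp2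
  have hd : MemLp (fun p : EuclideanSpace ℝ (Fin N) × EuclideanSpace ℝ (Fin N) =>
      dist p.1 p.2) 2 π := by
    simpa [dist_eq_norm, Function.comp_def] using
      (((memLp_two_norm_of_integrable_sq h2μ).comp_measurePreserving mp1).sub
        ((memLp_two_norm_of_integrable_sq h2ν).comp_measurePreserving mp2)).norm
  have e1 : kmeansF π.fst z = ∫ p, (⨅ i, dist p.1 (z i)) ^ 2 ∂π :=
    integral_map measurable_fst.aemeasurable (hc.pow 2).aestronglyMeasurable
  have e2 : kmeansF π.snd z = ∫ p, (⨅ i, dist p.2 (z i)) ^ 2 ∂π :=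
    integral_map measurable_snd.aemeasurable (hc.pow 2).aestronglyMeasurable
  rw [e1, e2, abs_sub_le_iff, sub_le_iff_le_add', sub_le_iff_le_add']
  constructor
  · exact sqrt_integral_sq_le_add l2 hd l1.1 (fun p => ciInf_dist_nonneg z _) fun p =>
      ciInf_dist_le_add z z _ _ _ fun i => by
        linarith [dist_triangle p.1 p.2 (z i)]
  · exact sqrt_integral_sq_le_add l1 hd l2.1 (fun p => ciInf_dist_nonneg z _) fun p =>
      ciInf_dist_le_add z z _ _ _ fun i => by
        linarith [dist_triangle p.2 p.1 (z i), dist_comm p.1 p.2]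

lemma lintegral_ciInf_dist_sq [NeZero k] {μ : Measure (EuclideanSpace ℝ (Fin N))}
    [IsFiniteMeasure μ] (h2 : Integrable (fun x => ‖x‖ ^ 2) μ)
    (z : Fin k → EuclideanSpace ℝ (Fin N)) :
    ∫⁻ x, ENNReal.ofReal ((⨅ i, dist x (z i)) ^ 2) ∂μ = ENNReal.ofReal (kmeansF μ z) :=
  (ofReal_integral_eq_lintegral_ofReal (memLp_ciInf_dist h2 z).integrable_sq
    (.of_forall fun _ => sq_nonneg _)).symm

/-- If some coordinates of `u m` escape to infinity, then replacing them by a point of the support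
distinct from the limits of the other coordinates strictly decreases the functional. -/
lemma kmeansF_lt_liminf [NeZero k] {μ : Measure (EuclideanSpace ℝ (Fin N))}
    [IsFiniteMeasure μ] (h2 : Integrable (fun x => ‖x‖ ^ 2) μ)
    {u : ℕ → Fin k → EuclideanSpace ℝ (Fin N)} {w : Fin k → EuclideanSpace ℝ (Fin N)}
    {S : Set (Fin k)} {p : EuclideanSpace ℝ (Fin N)} (hp : p ∈ measSupport μ)
    (hconv : ∀ i ∈ S, Tendsto (fun m => u m i) atTop (𝓝 (w i)))
    (hesc : ∀ i ∉ S, Tendsto (fun m => ‖u m i‖) atTop atTop)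
    (hpS : ∀ i ∈ S, p ≠ w i) {j : Fin k} (hj : w j = p) :
    ENNReal.ofReal (kmeansF μ w) < liminf (fun m => ENNReal.ofReal (kmeansF μ (u m))) atTop := by
  have key : ∀ x c, 0 ≤ c → (∀ i ∈ S, c < dist x (w i)) →
      ENNReal.ofReal (c ^ 2) ≤
        liminf (fun m => ENNReal.ofReal ((⨅ i, dist x (u m i)) ^ 2)) atTop := by
    intro x c hc0 hc
    have hev : ∀ᶠ m in atTop, ∀ i, c < dist x (u m i) := by
      refine eventually_all.2 fun i => ?_
      by_cases hi : i ∈ S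
      · exact (tendsto_const_nhds.dist (hconv i hi)).eventually_const_lt (hc i hi)
      · filter_upwards [(hesc i hi).eventually_gt_atTop (c + ‖x‖)] with m hm
        have := norm_sub_norm_le (u m i) x
        rw [dist_comm, dist_eq_norm]
        linarith
    refine le_liminf_of_le (by isBoundedDefault) (hev.mono fun m hm => ?_)
    exact ENNReal.ofReal_le_ofReal (pow_le_pow_left₀ hc0 (le_ciInf fun i => (hm i).le) 2)
  have hle : ∀ x, ENNReal.ofReal ((⨅ i, dist x (w i)) ^ 2) ≤
      liminf (fun m => ENNReal.ofReal ((⨅ i, dist x (u m i)) ^ 2)) atTop := by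
    intro x
    rcases (ciInf_dist_nonneg w x).eq_or_lt with h0 | h0
    · simp [← h0]
    · have ht : Tendsto (fun c : ℝ => ENNReal.ofReal (c ^ 2)) (𝓝[<] (⨅ i, dist x (w i)))
          (𝓝 (ENNReal.ofReal ((⨅ i, dist x (w i)) ^ 2))) :=
        ((ENNReal.continuous_ofReal.comp (continuous_pow 2)).tendsto _).mono_left
          nhdsWithin_le_nhds
      refine le_of_tendsto ht ?_
      filter_upwards [Ioo_mem_nhdsLT h0] with c hc
      exact key x c hc.1.le fun i _ => hc.2.trans_le (ciInf_dist_le w x i)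
  obtain ⟨r, hr0, hr⟩ : ∃ r > 0, ∀ i ∈ S, 3 * r ≤ dist p (w i) := by
    have : ∀ᶠ r : ℝ in 𝓝[>] 0, ∀ i, i ∈ S → 3 * r ≤ dist p (w i) := by
      refine eventually_all.2 fun i => ?_
      by_cases hi : i ∈ S
      · have hd := dist_pos.2 (hpS i hi)
        filter_upwards [Ioo_mem_nhdsGT (show 0 < dist p (w i) / 3 by positivity)] with r hr _
        linarith [hr.2]
      · exact .of_forall fun _ h => absurd h hi
    obtain ⟨r, h1, h2⟩ := (this.and self_mem_nhdsWithin).exists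
    exact ⟨r, h2, h1⟩
  have hmeas : ∀ z : Fin k → EuclideanSpace ℝ (Fin N),
      Measurable fun x => ENNReal.ofReal ((⨅ i, dist x (z i)) ^ 2) := fun z =>
    (ENNReal.continuous_ofReal.comp ((continuous_ciInf_dist z).pow 2)).measurable
  have hlt := lintegral_strict_mono_of_ae_le_of_ae_lt_on (μ := μ)
    (Measurable.liminf fun m => hmeas (u m)).aemeasurable
    (by rw [lintegral_ciInf_dist_sq h2 w]; exact ENNReal.ofReal_ne_top)
    (.of_forall hle) (hp r hr0).ne' (.of_forall fun x hx => ?_)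
  · rw [lintegral_ciInf_dist_sq h2 w] at hlt
    refine hlt.trans_le ((lintegral_liminf_le fun m => hmeas (u m)).trans_eq ?_)
    simp_rw [lintegral_ciInf_dist_sq h2]
  · rw [Metric.mem_ball] at hx
    have hrx : ENNReal.ofReal ((3 / 2 * r) ^ 2) ≤ _ := key x (3 / 2 * r) (by positivity)
      fun i hi => by linarith [hr i hi, dist_triangle p x (w i), dist_comm p x]
    refine lt_of_lt_of_le ?_ hrx
    rw [ENNReal.ofReal_lt_ofReal_iff (by positivity)]
    refine pow_lt_pow_left₀ ?_ (ciInf_dist_nonneg w x) two_ne_zero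
    have := ciInf_dist_le w x j
    rw [hj] at this
    linarith

/-- A minimizing sequence of the k-means functional of a measure whose support has at least `k`
points has a convergent subsequence. -/
lemma exists_subseq_tendsto_of_minimizing [NeZero k]
    {μ : Measure (EuclideanSpace ℝ (Fin N))} [IsFiniteMeasure μ]
    (h2 : Integrable (fun x => ‖x‖ ^ 2) μ) (hsupp : (k : ℕ∞) ≤ (measSupport μ).encard)
    (u : ℕ → Fin k → EuclideanSpace ℝ (Fin N))
    (hu : ∀ w : Fin k → EuclideanSpace ℝ (Fin N), ∀ ε > 0, ∀ᶠ m in atTop, kmeansF μ (u m) ≤ kmeansF μ w + ε) :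
    ∃ φ : ℕ → ℕ, StrictMono φ ∧ ∃ z, Tendsto (fun m => u (φ m)) atTop (𝓝 z) := by
  classical
  obtain ⟨φ, hφ, h⟩ := exists_subseq_tendsto_or_norm_atTop Finset.univ u
  simp only [Finset.mem_univ, forall_const] at h
  refine ⟨φ, hφ, ?_⟩
  by_cases hall : ∀ i, ∃ a, Tendsto (fun m => u (φ m) i) atTop (𝓝 a)
  · choose z hz using hall
    exact ⟨z, tendsto_pi_nhds.2 hz⟩
  exfalso
  push Not at hall
  obtain ⟨j, hj⟩ := hall
  let S : Set (Fin k) := {i | ∃ a, Tendsto (fun m => u (φ m) i) atTop (𝓝 a)}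
  have hjS : j ∉ S := fun ⟨a, ha⟩ => hj a ha
  choose! a ha using fun i (hi : i ∈ S) => hi
  obtain ⟨p, hp, hpa⟩ : ∃ p ∈ measSupport μ, p ∉ a '' S := by
    by_contra! hcon
    have h1 : (k : ℕ∞) ≤ S.encard :=
      hsupp.trans ((Set.encard_le_encard hcon).trans (Set.encard_image_le a S))
    have h3 : S.encard < (Set.univ : Set (Fin k)).encard :=
      (Set.toFinite S).encard_lt_encard
        ((Set.ssubset_univ_iff).2 fun hS => hjS (hS ▸ Set.mem_univ j))
    simp only [Set.encard_univ, ENat.card_eq_coe_fintype_card, Fintype.card_fin] at h3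
    exact absurd h1 h3.not_ge
  let w : Fin k → EuclideanSpace ℝ (Fin N) := fun i => if i ∈ S then a i else p
  have hwS : ∀ i ∈ S, w i = a i := fun i hi => if_pos hi
  have hlt := kmeansF_lt_liminf (u := fun m => u (φ m)) (w := w) (S := S) h2 hp
    (fun i hi => by rw [hwS i hi]; exact ha i hi)
    (fun i hi => (h i).resolve_left hi)
    (fun i hi h => hpa ⟨i, hi, by rw [← hwS i hi, h]⟩) (if_neg hjS)
  refine hlt.not_ge ?_
  have ht : Tendsto (fun ε : ℝ => ENNReal.ofReal (kmeansF μ w + ε)) (𝓝[>] 0)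
      (𝓝 (ENNReal.ofReal (kmeansF μ w))) := by
    have : Continuous fun ε : ℝ => ENNReal.ofReal (kmeansF μ w + ε) :=
      ENNReal.continuous_ofReal.comp (by fun_prop)
    simpa using (this.tendsto 0).mono_left nhdsWithin_le_nhds
  refine ge_of_tendsto ht ?_
  filter_upwards [self_mem_nhdsWithin] with ε hε
  refine liminf_le_of_frequently_le' (Eventually.frequently ?_)
  filter_upwards [hφ.tendsto_atTop.eventually (hu w ε hε)] with m hm
  exact ENNReal.ofReal_le_ofReal hm

end KMeans

/-- If `μ_m → μ` in the 2-Wasserstein distance, the support of `μ` has at least `k` points and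
`z_m` minimizes `F_{μ_m,k}`, then `(z_m)` is precompact in `(ℝ^N)^k` and every accumulation
point is a minimizer of `F_{μ,k}`. -/
theorem kmeans_minimizers_stability (N k : ℕ) (hk : 0 < k)
    (μ : Measure (EuclideanSpace ℝ (Fin N))) [IsProbabilityMeasure μ]
    (h2 : Integrable (fun x => ‖x‖ ^ 2) μ)
    (hsupp : (k : ℕ∞) ≤ (measSupport μ).encard)
    (μs : ℕ → Measure (EuclideanSpace ℝ (Fin N)))
    (hprob : ∀ m, IsProbabilityMeasure (μs m))
    (h2s : ∀ m, Integrable (fun x => ‖x‖ ^ 2) (μs m))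
    (hconv : Tendsto (fun m => wasserstein2 (μs m) μ) atTop (nhds 0))
    (zs : ℕ → Fin k → EuclideanSpace ℝ (Fin N))
    (hmin : ∀ m, ∀ w : Fin k → EuclideanSpace ℝ (Fin N), kmeansF (μs m) (zs m) ≤ kmeansF (μs m) w) :
    (∃ φ : ℕ → ℕ, StrictMono φ ∧ ∃ z : Fin k → EuclideanSpace ℝ (Fin N),
        Tendsto (fun m => zs (φ m)) atTop (nhds z))
    ∧ (∀ z : Fin k → EuclideanSpace ℝ (Fin N), MapClusterPt z atTop zs →
        ∀ w : Fin k → EuclideanSpace ℝ (Fin N), kmeansF μ z ≤ kmeansF μ w) := by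
  have : NeZero k := ⟨hk.ne'⟩
  have hnn : ∀ z : Fin k → EuclideanSpace ℝ (Fin N), 0 ≤ kmeansF μ z := fun z =>
    integral_nonneg fun x => sq_nonneg _
  have hopt : ∀ m (w : Fin k → EuclideanSpace ℝ (Fin N)), √(kmeansF μ (zs m)) ≤ √(kmeansF μ w) + 2 * wasserstein2 (μs m) μ := by
    intro m w
    have := hprob m
    have h1 := abs_le.1 (abs_sqrt_kmeansF_sub_le_wasserstein2 (h2s m) h2 (zs m))
    have h3 := abs_le.1 (abs_sqrt_kmeansF_sub_le_wasserstein2 (h2s m) h2 w)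
    linarith [Real.sqrt_le_sqrt (hmin m w), h1.1, h3.2]
  constructor
  · refine exists_subseq_tendsto_of_minimizing h2 hsupp zs fun w ε hε => ?_
    have ht : Tendsto (fun m => (√(kmeansF μ w) + 2 * wasserstein2 (μs m) μ) ^ 2) atTop
        (𝓝 (kmeansF μ w)) := by
      simpa [Real.sq_sqrt (hnn w)] using ((hconv.const_mul 2).const_add √(kmeansF μ w)).pow 2
    filter_upwards [ht.eventually_le_const (lt_add_of_pos_right _ hε)] with m hm
    refine le_trans ?_ hm
    rw [← Real.sqrt_le_left ((Real.sqrt_nonneg _).trans (hopt m w))]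
    exact hopt m w
  · intro z hz w
    rw [← Real.sqrt_le_sqrt_iff (hnn w)]
    refine le_of_forall_pos_le_add fun ε hε => ?_
    have hW : ∀ᶠ m in atTop, 2 * wasserstein2 (μs m) μ < ε / 2 :=
      (hconv.const_mul 2).eventually_lt_const (by simpa using half_pos hε)
    obtain ⟨m, hm, hWm⟩ :=
      ((mapClusterPt_iff_frequently.1 hz _ (Metric.ball_mem_nhds z (half_pos hε))).and_eventually
        hW).exists
    rw [Metric.mem_ball, dist_comm] at hm
    linarith [sqrt_kmeansF_le_add_dist h2 z (zs m), hopt m w]
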